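/- arXiv:2511.04103 — 3 statements merged into one kernel-verified Lean document; each statement's English description precedes it below -/
import Mathlib

section
/- Let U be a countable set, let C : ℕ → Set U be a language collection with every C i nonempty, and let k ≥ 1. If C satisfies the k-Angluin condition, then there exists a k-list identifier A such that for every index z and every probability distribution D valid for C z, there exist constants c_1 > 0 and c_2 > 0 (depending on z, D, and C) such that for every t ∈ ℕ, Pr_{(x_1,…,x_t) ~ D^t}[no i ∈ A(x_1, …, x_t) satisfies C i = C z] ≤ c_1 · e^{-c_2 · t}. -/
open MeasureTheory

/-- The finite sequence consisting of the first `t` values of `x`. -/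
def prefixList {U : Type*} (x : ℕ → U) (t : ℕ) : List U :=
  List.ofFn (fun j : Fin t => x j)

/-- The probability distribution `D` on `U` is valid for the language `L`:
`D({u}) > 0` if and only if `u ∈ L`. -/
def IsValidFor {U : Type*} [MeasurableSpace U] (D : Measure U) (L : Set U) : Prop :=
  IsProbabilityMeasure D ∧ ∀ u : U, 0 < D {u} ↔ u ∈ L

/-- `μ` is the infinite i.i.d. product `D^∞` on `U^ℕ` of the distribution `D`:
it is a probability measure whose finite-dimensional cylinder marginals are products of
`D`.  In particular, for an event depending only on the first `t` coordinates,
`μ` of that event is the probability of the event under the `t`-fold product `D^t`. -/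
def IsIIDProduct {U : Type*} [MeasurableSpace U] (D : Measure U)
    (μ : Measure (ℕ → U)) : Prop :=
  IsProbabilityMeasure μ ∧
  ∀ (t : ℕ) (S : Fin t → Set U),
    μ {f : ℕ → U | ∀ j : Fin t, f (j : ℕ) ∈ S j} = ∏ j : Fin t, D (S j)

/-- The recursive Angluin predicates `Ψ_k`. -/
def Psi {U : Type*} (C : ℕ → Set U) : ℕ → Set U → Prop
  | 0, _ => True
  | 1, L => ∃ T : Finset U, (T : Set U) ⊆ L ∧
      ∀ j : ℕ, C j ⊂ L → ¬((T : Set U) ⊆ C j)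
  | (k + 2), L => ∃ T : Finset U, (T : Set U) ⊆ L ∧
      ∀ j : ℕ, C j ⊂ L → ¬((T : Set U) ⊆ C j) ∨ Psi C (k + 1) (C j)

/-- The collection `C` satisfies the `k`-Angluin condition. -/
def AngluinCondition {U : Type*} (C : ℕ → Set U) (k : ℕ) : Prop :=
  ∀ i : ℕ, Psi C k (C i)

lemma Psi.exists_finset {U : Type*} {C : ℕ → Set U} {n : ℕ} {L : Set U}
    (h : Psi C (n + 1) L) :
    ∃ T : Finset U, (T : Set U) ⊆ L ∧
      ∀ j, C j ⊂ L → (T : Set U) ⊆ C j → ∃ m < n, Psi C (m + 1) (C j) := by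
  cases n with
  | zero =>
    obtain ⟨T, hT, hj⟩ := h
    exact ⟨T, hT, fun j h₁ h₂ => absurd h₂ (hj j h₁)⟩
  | succ n =>
    obtain ⟨T, hT, hj⟩ := h
    exact ⟨T, hT, fun j h₁ h₂ => ⟨n, n.lt_succ_self, (hj j h₁).resolve_left (not_not.2 h₂)⟩⟩

/-- A language is pinned down, among those satisfying a property `P`, by finitely many of its
elements: if the finite sets `T i` separate every `C i` satisfying `P` from its proper
sublanguages satisfying `P`, then the least consistent index is eventually correct. -/
lemma exists_locking_finset {U : Type*} (C : ℕ → Set U) (T : ℕ → Finset U) (P : Set U → Prop)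
    (hT : ∀ i, P (C i) → (T i : Set U) ⊆ C i)
    (hsep : ∀ i j, P (C i) → P (C j) → C j ⊂ C i → ¬ (T i : Set U) ⊆ C j)
    (z : ℕ) (hz : P (C z)) :
    ∃ F : Finset U, (F : Set U) ⊆ C z ∧ ∀ S : Set U, (F : Set U) ⊆ S → S ⊆ C z →
      (∃ i, P (C i) ∧ (T i : Set U) ⊆ S ∧ S ⊆ C i) ∧
      ∀ i, IsLeast {i | P (C i) ∧ (T i : Set U) ⊆ S ∧ S ⊆ C i} i → C i = C z := by
  classical
  have hw : ∀ i, ∃ W : Finset U, (W : Set U) ⊆ C z ∧ (¬ C z ⊆ C i → ¬ (W : Set U) ⊆ C i) := by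
    intro i
    by_cases hi : C z ⊆ C i
    · exact ⟨∅, by simp, fun h => absurd hi h⟩
    · obtain ⟨u, hu, hui⟩ := Set.not_subset.1 hi
      exact ⟨{u}, by simpa using hu, fun _ => by simpa using hui⟩
  choose W hWz hW using hw
  refine ⟨T z ∪ (Finset.range z).biUnion W, ?_, fun S hFS hSz => ?_⟩
  · intro u hu
    simp only [Finset.coe_union, Finset.coe_biUnion, Set.mem_union, Set.mem_iUnion] at hu
    rcases hu with hu | ⟨i, _, hu⟩
    · exact hT z hz hu
    · exact hWz i hu
  · have hTz : (T z : Set U) ⊆ S := fun u hu => hFS (by simp at hu; simp [hu])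
    refine ⟨⟨z, hz, hTz, hSz⟩, fun i hi => ?_⟩
    obtain ⟨⟨hPi, hTi, hSi⟩, hmin⟩ := hi
    rcases (hmin ⟨hz, hTz, hSz⟩ : i ≤ z).eq_or_lt with rfl | hlt
    · rfl
    have hsub : C z ⊆ C i := by
      by_contra hcon
      refine hW i hcon (fun u hu => hSi (hFS ?_))
      simp only [Finset.coe_union, Finset.coe_biUnion, Set.mem_union, Set.mem_iUnion]
      exact Or.inr ⟨i, by simpa using hlt, hu⟩
    by_contra hne
    exact hsep i z hPi hz (hsub.ssubset_of_ne (Ne.symm hne)) (hTi.trans hSz)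

/-- Under the `k`-Angluin condition there is a list identifier, depending only on the set of
observed elements, that is correct on every sample from `C z` containing a suitable finite set. -/
lemma AngluinCondition.exists_identifier {U : Type*} {C : ℕ → Set U} {k : ℕ} (hk : 1 ≤ k)
    (h : AngluinCondition C k) :
    ∃ A : Set U → Finset ℕ, (∀ S, (A S).card ≤ k) ∧
      ∀ z, ∃ F : Finset U, (F : Set U) ⊆ C z ∧ ∀ S : Set U, (F : Set U) ⊆ S → S ⊆ C z →
        ∃ i ∈ A S, C i = C z := by
  classical
  obtain ⟨k, rfl⟩ : ∃ n, k = n + 1 := ⟨k - 1, by omega⟩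
  let R : ℕ → Set U → Prop := fun r L => Psi C (r + 1) L ∧ ∀ m < r, ¬ Psi C (m + 1) L
  have hR : ∀ i, ∃ r < k + 1, R r (C i) := by
    intro i
    have hex : ∃ r, Psi C (r + 1) (C i) := ⟨k, h i⟩
    exact ⟨Nat.find hex, Nat.lt_succ_of_le (Nat.find_min' hex (h i)), Nat.find_spec hex,
      fun m hm => Nat.find_min hex hm⟩
  have hT : ∀ r i, ∃ T : Finset U, R r (C i) → (T : Set U) ⊆ C i ∧
      ∀ j, C j ⊂ C i → (T : Set U) ⊆ C j → ∃ m < r, Psi C (m + 1) (C j) := by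
    intro r i
    by_cases hr : R r (C i)
    · obtain ⟨T, hT⟩ := hr.1.exists_finset
      exact ⟨T, fun _ => hT⟩
    · exact ⟨∅, fun hcon => absurd hcon hr⟩
  choose T hT using hT
  let G : ℕ → Set U → Finset ℕ := fun r S =>
    if hex : ∃ i, R r (C i) ∧ (T r i : Set U) ⊆ S ∧ S ⊆ C i then {Nat.find hex} else ∅
  refine ⟨fun S => (Finset.range (k + 1)).biUnion fun r => G r S, fun S => ?_, fun z => ?_⟩
  · refine (Finset.card_biUnion_le_card_mul _ _ 1 fun r _ => ?_).trans (by simp)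
    dsimp only [G]
    split_ifs <;> simp
  · obtain ⟨r, hrk, hr⟩ := hR z
    obtain ⟨F, hFz, hF⟩ := exists_locking_finset C (T r) (R r) (fun i hi => (hT r i hi).1)
      (fun i j hi hj hji hTj => by
        obtain ⟨m, hm, hPsi⟩ := (hT r i hi).2 j hji hTj
        exact hj.2 m hm hPsi) z hr
    refine ⟨F, hFz, fun S hFS hSz => ?_⟩
    obtain ⟨hex, hleast⟩ := hF S hFS hSz
    refine ⟨Nat.find hex, Finset.mem_biUnion.2 ⟨r, Finset.mem_range.2 hrk, ?_⟩,
      hleast _ ⟨Nat.find_spec hex, fun i hi => Nat.find_min' hex hi⟩⟩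
    simp [G, hex]

lemma IsValidFor.measure_compl_eq_zero {U : Type*} [Countable U] [MeasurableSpace U]
    {D : Measure U} {L : Set U} (hD : IsValidFor D L) : D Lᶜ = 0 := by
  rw [← Set.biUnion_of_singleton Lᶜ]
  refine (measure_biUnion_null_iff (Set.to_countable _)).2 fun u hu => ?_
  by_contra hne
  exact hu ((hD.2 u).1 (pos_iff_ne_zero.2 hne))

lemma IsIIDProduct.measure_coord_mem {U : Type*} [MeasurableSpace U] {D : Measure U}
    {μ : Measure (ℕ → U)} (hμ : IsIIDProduct D μ) {N : Set U} (hN : D N = 0) (j : ℕ) :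
    μ {x | x j ∈ N} = 0 := by
  have hcyl := hμ.2 (j + 1) fun i => if (i : ℕ) = j then N else Set.univ
  rw [Finset.prod_eq_zero (Finset.mem_univ (Fin.last j)) (by simpa using hN)] at hcyl
  refine measure_mono_null ?_ hcyl
  intro x hx i
  by_cases hi : (i : ℕ) = j
  · simpa [hi] using hx
  · simp [hi]

lemma exists_measure_compl_singleton_le_exp {U : Type*} [MeasurableSpace U]
    [MeasurableSingletonClass U] (D : Measure U) [IsProbabilityMeasure D] (F : Finset U)
    (hF : ∀ u ∈ F, 0 < D {u}) :
    ∃ c : ℝ, 0 < c ∧ ∀ u ∈ F, D {u}ᶜ ≤ ENNReal.ofReal (Real.exp (-c)) := by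
  classical
  induction F using Finset.induction_on with
  | empty => exact ⟨1, one_pos, by simp⟩
  | insert a F ha ih =>
    obtain ⟨c, hc, hcF⟩ := ih fun u hu => hF u (Finset.mem_insert_of_mem hu)
    have hpos : 0 < D.real {a} := by
      rw [measureReal_def]
      exact ENNReal.toReal_pos (hF a (Finset.mem_insert_self a F)).ne' (measure_ne_top D _)
    refine ⟨min c (D.real {a}), lt_min hc hpos, fun u hu => ?_⟩
    rcases Finset.mem_insert.1 hu with rfl | hu
    · rw [← ENNReal.ofReal_toReal (measure_ne_top D {u}ᶜ), ← measureReal_def,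
        probReal_compl_eq_one_sub (measurableSet_singleton u)]
      refine ENNReal.ofReal_le_ofReal ((Real.one_sub_le_exp_neg _).trans ?_)
      exact Real.exp_le_exp.2 (neg_le_neg (min_le_right _ _))
    · exact (hcF u hu).trans
        (ENNReal.ofReal_le_ofReal (Real.exp_le_exp.2 (neg_le_neg (min_le_left _ _))))

lemma IsIIDProduct.measure_unseen_le {U : Type*} [MeasurableSpace U] {D : Measure U}
    {μ : Measure (ℕ → U)} (hμ : IsIIDProduct D μ) {F : Finset U} {c : ℝ}
    (hF : ∀ u ∈ F, D {u}ᶜ ≤ ENNReal.ofReal (Real.exp (-c))) (t : ℕ) :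
    μ {x | ∃ u ∈ F, ∀ j : Fin t, x j ≠ u} ≤
      ENNReal.ofReal (F.card * Real.exp (-(c * t))) := by
  have hset : {x : ℕ → U | ∃ u ∈ F, ∀ j : Fin t, x j ≠ u} =
      ⋃ u ∈ F, {x | ∀ j : Fin t, x j ∈ ({u}ᶜ : Set U)} := by
    ext x; simp
  have hu : ∀ u ∈ F, μ {x | ∀ j : Fin t, x j ∈ ({u}ᶜ : Set U)} ≤
      ENNReal.ofReal (Real.exp (-(c * t))) := by
    intro u hu
    rw [hμ.2 t fun _ => {u}ᶜ, Finset.prod_const, Finset.card_univ, Fintype.card_fin]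
    refine (pow_le_pow_left' (hF u hu) t).trans_eq ?_
    rw [← ENNReal.ofReal_pow (Real.exp_pos _).le, ← Real.exp_nat_mul]
    congr 2
    ring
  rw [hset]
  refine (measure_biUnion_finset_le F _).trans ((Finset.sum_le_sum hu).trans_eq ?_)
  rw [Finset.sum_const, nsmul_eq_mul, ENNReal.ofReal_mul (Nat.cast_nonneg _),
    ENNReal.ofReal_natCast]

/-- If `C` satisfies the `k`-Angluin condition, then there is a `k`-list
identifier `A` such that for every index `z` and every distribution `D` valid for `C z`
there are constants `c₁, c₂ > 0` with: for every `t`, the probability (under `t` i.i.d.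
draws from `D`, expressed via the infinite product measure) that no guess in
`A(x_1, …, x_t)` equals `C z` is at most `c₁ · exp(-c₂ · t)`. -/
theorem angluin_implies_exponential_rate {U : Type*} [Countable U] [MeasurableSpace U]
    [MeasurableSingletonClass U]
    (C : ℕ → Set U) (hC : ∀ i, (C i).Nonempty) (k : ℕ) (hk : 1 ≤ k)
    (h : AngluinCondition C k) :
    ∃ A : List U → Finset ℕ, (∀ s, (A s).card ≤ k) ∧
      ∀ z : ℕ, ∀ D : Measure U, IsValidFor D (C z) →
        ∃ c₁ : ℝ, 0 < c₁ ∧ ∃ c₂ : ℝ, 0 < c₂ ∧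
          ∀ μ : Measure (ℕ → U), IsIIDProduct D μ →
            ∀ t : ℕ,
              μ {x : ℕ → U | ∀ i ∈ A (prefixList x t), C i ≠ C z} ≤
                ENNReal.ofReal (c₁ * Real.exp (-(c₂ * t))) := by
  obtain ⟨A, hcard, hA⟩ := h.exists_identifier hk
  refine ⟨fun s => A {u | u ∈ s}, fun s => hcard _, fun z D hD => ?_⟩
  have := hD.1
  obtain ⟨F, hFz, hF⟩ := hA z
  obtain ⟨c, hc, hcF⟩ := exists_measure_compl_singleton_le_exp D F
    fun u hu => (hD.2 u).2 (hFz hu)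
  refine ⟨F.card + 1, by positivity, c, hc, fun μ hμ t => ?_⟩
  have hnull : μ (⋃ j : ℕ, {x | x j ∈ (C z)ᶜ}) = 0 :=
    measure_iUnion_null fun j => hμ.measure_coord_mem hD.measure_compl_eq_zero j
  have hsub : {x : ℕ → U | ∀ i ∈ A {u | u ∈ prefixList x t}, C i ≠ C z} ⊆
      (⋃ j : ℕ, {x | x j ∈ (C z)ᶜ}) ∪ {x | ∃ u ∈ F, ∀ j : Fin t, x j ≠ u} := by
    intro x hx
    by_contra hcon
    simp only [Set.mem_union, Set.mem_iUnion, Set.mem_ofPred_eq, Set.mem_compl_iff, not_or,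
      not_exists, not_and, not_not, not_forall] at hcon
    obtain ⟨hxz, hxF⟩ := hcon
    obtain ⟨i, hi, hiz⟩ := hF {u | u ∈ prefixList x t}
      (fun u hu => by
        obtain ⟨j, hj⟩ := hxF u hu
        exact List.mem_ofFn.2 ⟨j, hj⟩)
      (fun u hu => by
        obtain ⟨j, rfl⟩ := List.mem_ofFn.1 hu
        exact hxz j)
    exact hx i hi hiz
  calc _ ≤ _ := measure_mono hsub
    _ ≤ _ := measure_union_le _ _
    _ ≤ 0 + ENNReal.ofReal (F.card * Real.exp (-(c * t))) :=
      add_le_add hnull.le (hμ.measure_unseen_le hcF t)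
    _ ≤ _ := by
      rw [zero_add]
      gcongr
      simp
end

section
/- Let U be a countable set, let C : ℕ → Set U be a language collection with every C i nonempty, and let k ≥ 1. Suppose C is non-trivial for k-list identification, i.e., there exist k+1 indices i_1, …, i_{k+1} such that the languages C i_1, …, C i_{k+1} are pairwise distinct and their intersection is nonempty. Then for every k-list identifier A there exist an index z and a probability distribution D valid for C z such that Pr_{(x_1,…,x_t) ~ D^t}[no i ∈ A(x_1, …, x_t) satisfies C i = C z] ≥ e^{-2t} for infinitely many t ∈ ℕ. -/
open MeasureTheory

/-- Every nonempty countable set `L` carries a valid distribution giving mass at least `1 / 2` to a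
prescribed point of `L`. -/
theorem exists_isValidFor_half_le {U : Type*} [Countable U] [MeasurableSpace U]
    [MeasurableSingletonClass U] {L : Set U} {u : U} (hu : u ∈ L) :
    ∃ D : Measure U, IsValidFor D L ∧ 2⁻¹ ≤ D {u} := by
  obtain ⟨f, hf⟩ := L.to_countable.exists_eq_range ⟨u, hu⟩
  let g : ℕ → U := fun n => Nat.casesOn n u f
  have hg : ∀ v, v ∈ L ↔ ∃ n, g n = v := by
    intro v
    constructor
    · intro hv
      rw [hf] at hv
      obtain ⟨n, rfl⟩ := hv
      exact ⟨n + 1, rfl⟩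
    · rintro ⟨_ | n, rfl⟩
      · exact hu
      · rw [hf]
        exact ⟨n, rfl⟩
  let D : Measure U := Measure.sum fun n => (2⁻¹ : ENNReal) ^ (n + 1) • Measure.dirac (g n)
  have hpos : ∀ n : ℕ, (2⁻¹ : ENNReal) ^ (n + 1) ≠ 0 := fun n => pow_ne_zero _ (by simp)
  have hle : ∀ n : ℕ, (2⁻¹ : ENNReal) ^ (n + 1) ≤ D {g n} := by
    intro n
    have h := Measure.le_sum (fun n => (2⁻¹ : ENNReal) ^ (n + 1) • Measure.dirac (g n)) n {g n}
    simpa only [Measure.smul_apply, Measure.dirac_apply_of_mem (Set.mem_singleton _), smul_eq_mul,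
      mul_one] using h
  refine ⟨D, ⟨⟨?_⟩, fun v => ?_⟩, by simpa [g] using hle 0⟩
  · simp only [D, Measure.sum_apply _ MeasurableSet.univ, Measure.smul_apply,
      Measure.dirac_apply_of_mem (Set.mem_univ _), smul_eq_mul, mul_one]
    rw [ENNReal.tsum_geometric_add_one, ENNReal.one_sub_inv_two, inv_inv]
    exact ENNReal.inv_mul_cancel (by simp) (by simp)
  · rw [hg]
    constructor
    · contrapose!
      intro h
      simp [D, Measure.sum_apply _ (measurableSet_singleton v), h]
    · rintro ⟨n, rfl⟩
      exact (pos_iff_ne_zero.2 (hpos n)).trans_le (hle n)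

/-- A list of `k` indices misses one of `k + 1` pairwise distinct languages. -/
theorem exists_forall_mem_ne {β : Type*} {C : ℕ → β} {k : ℕ} {idx : Fin (k + 1) → ℕ}
    (hidx : ∀ a b : Fin (k + 1), a ≠ b → C (idx a) ≠ C (idx b)) {s : Finset ℕ}
    (hs : s.card ≤ k) : ∃ a, ∀ i ∈ s, C i ≠ C (idx a) := by
  by_contra! h
  choose f hfs hf using h
  have hinj : Function.Injective f := fun a b hab => by
    by_contra hne
    exact hidx a b hne (by rw [← hf a, ← hf b, hab])
  have hcard := Finset.card_le_card_of_injOn (s := Finset.univ) f (fun a _ => hfs a) hinj.injOn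
  rw [Finset.card_univ, Fintype.card_fin] at hcard
  omega

/-- The first `t` draws all equal `u` with probability at least `D {u} ^ t`. -/
theorem IsIIDProduct.pow_le {U : Type*} [MeasurableSpace U] {D : Measure U}
    {μ : Measure (ℕ → U)} (h : IsIIDProduct D μ) (u : U) (t : ℕ) {E : Set (ℕ → U)}
    (hE : ∀ x : ℕ → U, prefixList x t = List.replicate t u → x ∈ E) : D {u} ^ t ≤ μ E := by
  have hcyl := h.2 t fun _ => {u}
  rw [Finset.prod_const, Finset.card_univ, Fintype.card_fin] at hcyl
  rw [← hcyl]
  refine measure_mono fun x hx => hE x ?_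
  have hx' : (fun j : Fin t => x j) = fun _ => u := funext hx
  rw [prefixList, hx', List.ofFn_const]

theorem ofReal_exp_neg_two_mul_le (t : ℕ) :
    ENNReal.ofReal (Real.exp (-(2 * (t : ℝ)))) ≤ (2⁻¹ : ENNReal) ^ t := by
  have h : Real.exp (-2) ≤ 2⁻¹ := by
    rw [Real.exp_neg]
    exact inv_anti₀ two_pos (by linarith [Real.add_one_le_exp (2 : ℝ)])
  have h2 : ENNReal.ofReal (2⁻¹ : ℝ) = 2⁻¹ := by
    rw [ENNReal.ofReal_inv_of_pos two_pos, ENNReal.ofReal_ofNat]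
  rw [← h2, ← ENNReal.ofReal_pow (by norm_num)]
  refine ENNReal.ofReal_le_ofReal ?_
  calc Real.exp (-(2 * (t : ℝ))) = Real.exp (-2) ^ t := by rw [← Real.exp_nat_mul]; ring_nf
    _ ≤ 2⁻¹ ^ t := by gcongr

/-- If `C` is non-trivial for `k`-list identification (there are `k+1`
indices whose languages are pairwise distinct and share a common element), then for every
`k`-list identifier `A` there are an index `z` and a distribution `D` valid for `C z` such
that, for infinitely many `t`, the probability (under `t` i.i.d. draws from `D`, expressed
via the infinite product measure) that no guess in `A(x_1, …, x_t)` equals `C z` is at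
least `e^{-2t}`. -/
theorem exponential_rate_best_possible {U : Type*} [Countable U] [MeasurableSpace U]
    [MeasurableSingletonClass U]
    (C : ℕ → Set U) (hC : ∀ i, (C i).Nonempty) (k : ℕ) (hk : 1 ≤ k)
    (hnt : ∃ idx : Fin (k + 1) → ℕ,
      (∀ a b : Fin (k + 1), a ≠ b → C (idx a) ≠ C (idx b)) ∧
      (⋂ a : Fin (k + 1), C (idx a)).Nonempty) :
    ∀ A : List U → Finset ℕ, (∀ s, (A s).card ≤ k) →
      ∃ z : ℕ, ∃ D : Measure U, IsValidFor D (C z) ∧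
        ∀ μ : Measure (ℕ → U), IsIIDProduct D μ →
          ∀ N : ℕ, ∃ t ≥ N,
            ENNReal.ofReal (Real.exp (-(2 * (t : ℝ)))) ≤
              μ {x : ℕ → U | ∀ i ∈ A (prefixList x t), C i ≠ C z} := by
  obtain ⟨idx, hidx, u, hu⟩ := hnt
  rw [Set.mem_iInter] at hu
  intro A hA
  have hmiss : ∃ a, ∃ᶠ t in Filter.atTop,
      ∀ i ∈ A (List.replicate t u), C i ≠ C (idx a) := by
    by_contra! h
    obtain ⟨t, ht⟩ := (Filter.eventually_all.2 h).exists
    obtain ⟨a, ha⟩ := exists_forall_mem_ne hidx (hA (List.replicate t u))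
    obtain ⟨i, hi, hCi⟩ := ht a
    exact ha i hi hCi
  obtain ⟨a, ha⟩ := hmiss
  obtain ⟨D, hD, hDu⟩ := exists_isValidFor_half_le (hu a)
  refine ⟨idx a, D, hD, fun μ hμ N => ?_⟩
  obtain ⟨t, htN, ht⟩ := Filter.frequently_atTop.1 ha N
  refine ⟨t, htN, (ofReal_exp_neg_two_mul_le t).trans ((pow_le_pow_left' hDu t).trans ?_)⟩
  refine hμ.pow_le u t fun x hx => ?_
  rw [Set.mem_ofPred_eq, hx]
  exact ht
end

section
/- Let U be a countable set, let C : ℕ → Set U be a language collection with every C i nonempty, and let k ≥ 1. Suppose that for every k+1 indices i_1, …, i_{k+1} whose languages C i_1, …, C i_{k+1} are pairwise distinct, the intersection C i_1 ∩ … ∩ C i_{k+1} is empty. Then there exists a k-list identifier A such that for every index z, every enumeration x of C z, and every t ≥ 1, some i ∈ A(x 1, …, x t) satisfies C i = C z. -/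
/-- `x : ℕ → U` is an enumeration of the language `L ⊆ U`. -/
def IsEnumeration {U : Type*} (L : Set U) (x : ℕ → U) : Prop :=
  (∀ n, x n ∈ L) ∧ ∀ u ∈ L, ∃ n, x n = u

/-- `A` is a `k`-list identifier that identifies the collection `C` in the limit. -/
def IdentifiesInLimit {U : Type*} (C : ℕ → Set U) (k : ℕ) (A : List U → Finset ℕ) : Prop :=
  (∀ s, (A s).card ≤ k) ∧
  ∀ z : ℕ, ∀ x : ℕ → U, IsEnumeration (C z) x →
    ∃ tStar : ℕ, ∀ t ≥ tStar, ∃ i ∈ A (prefixList x t), C i = C z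

/-- The collection `C` is `k`-list identifiable in the limit. -/
def ListIdentifiable {U : Type*} (C : ℕ → Set U) (k : ℕ) : Prop :=
  ∃ A : List U → Finset ℕ, IdentifiesInLimit C k A


/-- If at most `k` distinct languages of the collection share any element, then for every `u`
at most `k` indices represent all the languages containing `u`. -/
theorem exists_card_le_representatives {U : Type*} (C : ℕ → Set U) (k : ℕ)
    (htriv : ∀ idx : Fin (k + 1) → ℕ,
      (∀ a b : Fin (k + 1), a ≠ b → C (idx a) ≠ C (idx b)) →
      (⋂ a : Fin (k + 1), C (idx a)) = ∅) (u : U) :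
    ∃ F : Finset ℕ, F.card ≤ k ∧ ∀ z, u ∈ C z → ∃ i ∈ F, C i = C z := by
  classical
  set T : Set (Set U) := {L | L ∈ Set.range C ∧ u ∈ L} with hT
  have hcard : T.encard ≤ k := by
    by_contra! hlt
    obtain ⟨S, hST, hS⟩ := Set.exists_subset_encard_eq (Order.add_one_le_of_lt hlt)
    have hfin : S.Finite := Set.finite_of_encard_eq_coe (k := k + 1) (by simpa using hS)
    have hn : hfin.toFinset.card = k + 1 := by
      rw [hfin.encard_eq_coe_toFinset_card] at hS
      exact_mod_cast hS
    let e := (hfin.toFinset.equivFinOfCardEq hn).symm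
    have he : ∀ a, (e a : Set U) ∈ T := fun a => hST (hfin.mem_toFinset.1 (e a).2)
    choose idx hidx using fun a => (he a).1
    have hempty := htriv idx fun a b hab h => hab <| e.injective <| Subtype.ext <| by
      rw [← hidx a, ← hidx b, h]
    have hu : u ∈ ⋂ a, C (idx a) := Set.mem_iInter.2 fun a => by
      rw [hidx a]
      exact (he a).2
    rw [hempty] at hu
    exact hu
  have hfin : T.Finite := Set.finite_of_encard_le_coe hcard
  refine ⟨hfin.toFinset.image (Function.invFun C), Finset.card_image_le.trans ?_, fun z hz => ?_⟩
  · rw [hfin.encard_eq_coe_toFinset_card] at hcard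
    exact_mod_cast hcard
  · exact ⟨Function.invFun C (C z),
      Finset.mem_image_of_mem _ (hfin.mem_toFinset.2 ⟨⟨z, rfl⟩, hz⟩), Function.invFun_eq ⟨z, rfl⟩⟩

/-- If every `k+1` indices carrying pairwise distinct languages have
languages with empty intersection, then there is a `k`-list identifier whose list contains
the identity of the target language at every time `t ≥ 1`, on every enumeration. -/
theorem trivial_collection_identified_immediately {U : Type*} [Countable U]
    (C : ℕ → Set U) (hC : ∀ i, (C i).Nonempty) (k : ℕ) (hk : 1 ≤ k)
    (htriv : ∀ idx : Fin (k + 1) → ℕ,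
      (∀ a b : Fin (k + 1), a ≠ b → C (idx a) ≠ C (idx b)) →
      (⋂ a : Fin (k + 1), C (idx a)) = ∅) :
    ∃ A : List U → Finset ℕ, (∀ s, (A s).card ≤ k) ∧
      ∀ z : ℕ, ∀ x : ℕ → U, IsEnumeration (C z) x →
        ∀ t ≥ 1, ∃ i ∈ A (prefixList x t), C i = C z := by
  choose F hF hrep using exists_card_le_representatives C k htriv
  refine ⟨fun s => s.head?.elim ∅ F, fun s => ?_, fun z x hx t ht => ?_⟩
  · cases s with
    | nil => simp
    | cons u s => exact hF u
  · obtain ⟨n, rfl⟩ := Nat.exists_eq_add_of_le' ht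
    simpa [prefixList, List.ofFn_succ] using hrep (x 0) z (hx.1 0)
end
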